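/- arXiv:1401.2725 — 8 statements merged into one kernel-verified Lean document; each statement's English description precedes it below -/
import Mathlib

section
/- For every integer m, the subgroup of SL(2,ℤ) generated by the three matrices [[1,3],[0,1]], [[1-3m, 3m²],[-3, 1+3m]], and [[4-3m, 3(m-1)²],[-3, 3m-2]] is equal to the principal congruence subgroup Γ(3). -/
open Matrix MatrixGroups CongruenceSubgroup

/-- The monodromy matrix `M_{1,0} = [[1,3],[0,1]]` for the Fermat `E₆⁽¹'¹⁾` family. -/
def M10 : SL(2, ℤ) := ⟨!![1, 3; 0, 1], by norm_num [Matrix.det_fin_two_of]⟩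

/-- The monodromy matrix `M_{2,0} = [[1-3m, 3m²],[-3, 1+3m]]` for the Fermat `E₆⁽¹'¹⁾` family. -/
def M20 (m : ℤ) : SL(2, ℤ) :=
  ⟨!![1 - 3 * m, 3 * m ^ 2; -3, 1 + 3 * m], by simp [Matrix.det_fin_two_of]; ring⟩

/-- The monodromy matrix `M_{3,0} = [[4-3m, 3(m-1)²],[-3, 3m-2]]` for the Fermat `E₆⁽¹'¹⁾`
family. -/
def M30 (m : ℤ) : SL(2, ℤ) :=
  ⟨!![4 - 3 * m, 3 * (m - 1) ^ 2; -3, 3 * m - 2], by simp [Matrix.det_fin_two_of]; ring⟩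

theorem coe_M10 : (M10 : Matrix (Fin 2) (Fin 2) ℤ) = !![1, 3; 0, 1] := rfl

theorem coe_M20 (m : ℤ) : (M20 m : Matrix (Fin 2) (Fin 2) ℤ) =
    !![1 - 3 * m, 3 * m ^ 2; -3, 1 + 3 * m] := rfl

theorem M30_eq_M20 (m : ℤ) : M30 m = M20 (m - 1) := by
  ext i j
  fin_cases i <;> fin_cases j <;> simp [M30, M20] <;> ring

theorem M20_mul_M20_mul_M20_mul_M10 (k : ℤ) :
    M20 (k - 1) * M20 k * M20 (k + 1) * M10 = 1 := by
  ext i j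
  fin_cases i <;> fin_cases j <;>
    simp [coe_M10, coe_M20, Matrix.mul_apply, Fin.sum_univ_two] <;> ring

/-- A subgroup containing `M10` and two consecutive matrices `M20` contains all of them. -/
theorem M20_mem_of_consecutive {H : Subgroup SL(2, ℤ)} {m : ℤ} (hT : M10 ∈ H)
    (hm : M20 m ∈ H) (hm' : M20 (m - 1) ∈ H) (k : ℤ) : M20 k ∈ H := by
  suffices h : M20 k ∈ H ∧ M20 (k - 1) ∈ H from h.1
  induction k using Int.inductionOn' (b := m) with
  | zero => exact ⟨hm, hm'⟩
  | succ k _ ih =>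
    have h := M20_mul_M20_mul_M20_mul_M10 k
    rw [add_sub_cancel_right]
    refine ⟨?_, ih.1⟩
    rw [← H.mul_mem_cancel_right hT, ← H.mul_mem_cancel_left (H.mul_mem ih.2 ih.1),
      ← mul_assoc, h]
    exact H.one_mem
  | pred k _ ih =>
    have h := M20_mul_M20_mul_M20_mul_M10 (k - 1)
    rw [sub_add_cancel] at h
    refine ⟨ih.2, ?_⟩
    rw [← H.mul_mem_cancel_right ih.2, ← H.mul_mem_cancel_right ih.1,
      ← H.mul_mem_cancel_right hT, h]
    exact H.one_mem

theorem mem_Gamma_three_iff {g : SL(2, ℤ)} :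
    g ∈ Gamma 3 ↔ (3 ∣ g 0 0 - 1 ∧ 3 ∣ g 0 1 ∧ 3 ∣ g 1 0 ∧ 3 ∣ g 1 1 - 1) := by
  have h (a : ℤ) : (a : ZMod 3) = 0 ↔ 3 ∣ a := by
    simpa using ZMod.intCast_zmod_eq_zero_iff_dvd a 3
  rw [Gamma_mem, ← h, ← h, ← h, ← h]
  simp [sub_eq_zero]

theorem M10_mem_Gamma_three : M10 ∈ Gamma 3 := by
  rw [mem_Gamma_three_iff]
  simp [M10]

theorem M20_mem_Gamma_three (k : ℤ) : M20 k ∈ Gamma 3 := by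
  rw [mem_Gamma_three_iff]
  simp only [coe_M20, Matrix.of_apply, Matrix.cons_val', Matrix.cons_val_zero,
    Matrix.cons_val_one, Matrix.cons_val_fin_one]
  exact ⟨⟨-k, by ring⟩, ⟨k ^ 2, by ring⟩, ⟨-1, by ring⟩, ⟨k, by ring⟩⟩

theorem M10_zpow (n : ℤ) : M10 ^ n = ModularGroup.T ^ (3 * n) := by
  have h : M10 = ModularGroup.T ^ (3 : ℤ) := by
    ext i j
    rw [ModularGroup.coe_T_zpow]
    rfl
  rw [h, _root_.zpow_mul]

theorem mul_M20_one_zero (g : SL(2, ℤ)) (k : ℤ) :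
    (g * M20 k) 1 0 = g 1 0 - 3 * (g 1 1 + k * g 1 0) := by
  simp [coe_M20, Matrix.mul_apply, Fin.sum_univ_two]
  ring

theorem mul_M20_inv_one_zero (g : SL(2, ℤ)) (k : ℤ) :
    (g * (M20 k)⁻¹) 1 0 = g 1 0 + 3 * (g 1 1 + k * g 1 0) := by
  simp [coe_M20, Matrix.mul_apply, Fin.sum_univ_two, Matrix.SpecialLinearGroup.coe_inv,
    Matrix.adjugate_fin_two]
  ring

theorem mem_of_mem_Gamma_three_of_one_zero_eq_zero {H : Subgroup SL(2, ℤ)} (hT : M10 ∈ H)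
    {g : SL(2, ℤ)} (hg : g ∈ Gamma 3) (hc : g 1 0 = 0) : g ∈ H := by
  obtain ⟨ha, ⟨n, hn⟩, -, hd⟩ := mem_Gamma_three_iff.1 hg
  have hdet := g.det_coe
  rw [Matrix.det_fin_two, hc, mul_zero, sub_zero] at hdet
  have h1 : g 0 0 = 1 ∧ g 1 1 = 1 := by
    rcases Int.mul_eq_one_iff_eq_one_or_neg_one.1 hdet with h | h
    · exact h
    · omega
  have h : g = M10 ^ n := by
    rw [M10_zpow]
    ext i j
    rw [ModularGroup.coe_T_zpow]
    fin_cases i <;> fin_cases j <;> simp [h1.1, h1.2, hc, hn]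
  rw [h]
  exact H.zpow_mem hT n

/-- If `3 ∣ c` and `c ≠ 0`, a bottom row `(c, d)` can be made shorter by some `M20 k` or its
inverse. -/
theorem exists_natAbs_one_zero_lt {g : SL(2, ℤ)} (h3 : 3 ∣ g 1 0) (hc : g 1 0 ≠ 0) :
    ∃ k : ℤ, ((g * M20 k) 1 0).natAbs < (g 1 0).natAbs ∨
      ((g * (M20 k)⁻¹) 1 0).natAbs < (g 1 0).natAbs := by
  simp only [mul_M20_one_zero, mul_M20_inv_one_zero]
  have hdvd : ¬ g 1 0 ∣ g 1 1 := by
    rintro ⟨t, ht⟩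
    have hdet := g.det_coe
    rw [Matrix.det_fin_two, ht] at hdet
    have : (3 : ℤ) ∣ 1 := h3.trans ⟨g 0 0 * t - g 0 1, by linarith⟩
    omega
  have hpos : 0 < g 1 1 % g 1 0 :=
    lt_of_le_of_ne (Int.emod_nonneg _ hc) fun h => hdvd (Int.dvd_of_emod_eq_zero h.symm)
  have hlt := Int.emod_lt_abs (g 1 1) hc
  have hdiv := Int.mul_ediv_add_emod (g 1 1) (g 1 0)
  set c := g 1 0
  set r := g 1 1 % c
  have habs := abs_cases c
  by_cases hr : 3 * r < 2 * |c|
  · refine ⟨-(g 1 1 / c), ?_⟩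
    have h : g 1 1 + -(g 1 1 / c) * c = r := by linarith
    rw [h]
    omega
  · rcases lt_or_gt_of_ne hc with hneg | hpos'
    · refine ⟨-(g 1 1 / c) + 1, ?_⟩
      have h : g 1 1 + (-(g 1 1 / c) + 1) * c = r + c := by linarith
      rw [h]
      omega
    · refine ⟨-(g 1 1 / c) - 1, ?_⟩
      have h : g 1 1 + (-(g 1 1 / c) - 1) * c = r - c := by linarith
      rw [h]
      omega

theorem Gamma_three_le {H : Subgroup SL(2, ℤ)} (hT : M10 ∈ H) (hU : ∀ k, M20 k ∈ H) :
    Gamma 3 ≤ H := by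
  intro g hg
  induction hn : (g 1 0).natAbs using Nat.strong_induction_on generalizing g with
  | _ n ih =>
    by_cases hc : g 1 0 = 0
    · exact mem_of_mem_Gamma_three_of_one_zero_eq_zero hT hg hc
    · obtain ⟨k, hk | hk⟩ := exists_natAbs_one_zero_lt (mem_Gamma_three_iff.1 hg).2.2.1 hc
      · exact (H.mul_mem_cancel_right (hU k)).1
          (ih _ (hn ▸ hk) (mul_mem hg (M20_mem_Gamma_three k)) rfl)
      · exact (H.mul_mem_cancel_right (H.inv_mem (hU k))).1
          (ih _ (hn ▸ hk) (mul_mem hg (inv_mem (M20_mem_Gamma_three k))) rfl)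

theorem stmt_0 (m : ℤ) :
    Subgroup.closure ({M10, M20 m, M30 m} : Set SL(2, ℤ)) = Gamma 3 := by
  rw [M30_eq_M20]
  apply le_antisymm
  · rw [Subgroup.closure_le]
    rintro g (rfl | rfl | rfl)
    · exact M10_mem_Gamma_three
    · exact M20_mem_Gamma_three m
    · exact M20_mem_Gamma_three (m - 1)
  · have hT : M10 ∈ Subgroup.closure ({M10, M20 m, M20 (m - 1)} : Set SL(2, ℤ)) :=
      Subgroup.subset_closure (by simp)
    exact Gamma_three_le hT (M20_mem_of_consecutive (m := m) hT
      (Subgroup.subset_closure (by simp)) (Subgroup.subset_closure (by simp)))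
end

section
/- The subgroup of SL(2,ℤ) generated by the two matrices A = [[1,2],[0,1]] and B = [[1,0],[-2,1]] is equal to the set of all matrices [[a,b],[c,d]] in SL(2,ℤ) satisfying a ≡ d ≡ 1 (mod 4) and b ≡ c ≡ 0 (mod 2). -/
open Matrix MatrixGroups

/-- The monodromy matrix `A = M_{1,0} = [[1,2],[0,1]]` for the Fermat `E₇⁽¹'¹⁾` family. -/
def A : SL(2, ℤ) := ⟨!![1, 2; 0, 1], by norm_num [Matrix.det_fin_two_of]⟩

/-- The monodromy matrix `B = M_{2,0} = [[1,0],[-2,1]]` for the Fermat `E₇⁽¹'¹⁾` family. -/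
def B : SL(2, ℤ) := ⟨!![1, 0; -2, 1], by norm_num [Matrix.det_fin_two_of]⟩

theorem sl_two_mul_apply (g h : SL(2, ℤ)) (i j : Fin 2) :
    (g * h) i j = g i 0 * h 0 j + g i 1 * h 1 j :=
  (Matrix.mul_apply (M := g.1) (N := h.1)).trans (Fin.sum_univ_two _)

theorem sl_two_coe_inv (g : SL(2, ℤ)) :
    (g⁻¹).1 = !![g 1 1, -g 0 1; -g 1 0, g 0 0] :=
  (Matrix.SpecialLinearGroup.coe_inv g).trans (adjugate_fin_two g.1)

theorem coe_A : A.1 = !![1, 2; 0, 1] := rfl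

theorem coe_B : B.1 = !![1, 0; -2, 1] := rfl

/-- The matrices in `SL(2, ℤ)` with diagonal entries `1` mod `4` and even off-diagonal entries. -/
def evenCongruenceSubgroup : Subgroup SL(2, ℤ) where
  carrier := {g | g 0 0 ≡ 1 [ZMOD 4] ∧ g 1 1 ≡ 1 [ZMOD 4] ∧
    g 0 1 ≡ 0 [ZMOD 2] ∧ g 1 0 ≡ 0 [ZMOD 2]}
  one_mem' := by simp [Int.ModEq]
  mul_mem' := by
    rintro g h ⟨ga, gd, gb, gc⟩ ⟨ha, hd, hb, hc⟩
    have four_dvd {x y : ℤ} (hx : x ≡ 0 [ZMOD 2]) (hy : y ≡ 0 [ZMOD 2]) :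
        x * y ≡ 0 [ZMOD 4] :=
      Int.modEq_zero_iff_dvd.2
        (mul_dvd_mul (Int.modEq_zero_iff_dvd.1 hx) (Int.modEq_zero_iff_dvd.1 hy))
    simp only [Set.mem_ofPred_eq, sl_two_mul_apply]
    refine ⟨by simpa using (ga.mul ha).add (four_dvd gb hc),
      by simpa using (four_dvd gc hb).add (gd.mul hd),
      by simpa using (hb.mul_left (g 0 0)).add (gb.mul_right (h 1 1)),
      by simpa using (gc.mul_right (h 0 0)).add (hc.mul_left (g 1 1))⟩
  inv_mem' := by
    rintro g ⟨ga, gd, gb, gc⟩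
    simp only [Set.mem_ofPred_eq, sl_two_coe_inv]
    exact ⟨gd, ga, by simpa using gb.neg, by simpa using gc.neg⟩

theorem mem_evenCongruenceSubgroup {g : SL(2, ℤ)} :
    g ∈ evenCongruenceSubgroup ↔ g 0 0 ≡ 1 [ZMOD 4] ∧ g 1 1 ≡ 1 [ZMOD 4] ∧
      g 0 1 ≡ 0 [ZMOD 2] ∧ g 1 0 ≡ 0 [ZMOD 2] :=
  Iff.rfl

theorem A_mem_evenCongruenceSubgroup : A ∈ evenCongruenceSubgroup := by
  simp [mem_evenCongruenceSubgroup, coe_A, Int.ModEq]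

theorem B_mem_evenCongruenceSubgroup : B ∈ evenCongruenceSubgroup := by
  simp [mem_evenCongruenceSubgroup, coe_B, Int.ModEq]

theorem coe_A_zpow (k : ℤ) : (A ^ k).1 = !![1, 2 * k; 0, 1] := by
  have hA : A = ModularGroup.T ^ (2 : ℤ) := Subtype.ext (ModularGroup.coe_T_zpow 2).symm
  rw [hA, ← _root_.zpow_mul, ModularGroup.coe_T_zpow]

theorem eq_A_zpow_of_apply_one_zero_eq_zero {g : SL(2, ℤ)} (hg : g ∈ evenCongruenceSubgroup)
    (hc : g 1 0 = 0) : ∃ k : ℤ, g = A ^ k := by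
  obtain ⟨ha, -, hb, -⟩ := mem_evenCongruenceSubgroup.1 hg
  obtain ⟨k, hk⟩ := Int.modEq_zero_iff_dvd.1 hb
  have hdet := g.det_coe
  rw [det_fin_two, hc, mul_zero, sub_zero] at hdet
  have had : g 0 0 = 1 ∧ g 1 1 = 1 := by
    rcases Int.mul_eq_one_iff_eq_one_or_neg_one.1 hdet with h | h
    · exact h
    · rw [h.1] at ha
      exact absurd ha (by decide)
  refine ⟨k, Subtype.ext ?_⟩
  rw [coe_A_zpow, eta_fin_two g.1]
  simp [had, hk, hc]

/-- Left multiplication by one of `A`, `A⁻¹`, `B`, `B⁻¹` shrinks the first column. -/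
theorem exists_mul_firstColumn_lt {g : SL(2, ℤ)} (hg : g ∈ evenCongruenceSubgroup)
    (hc : g 1 0 ≠ 0) : ∃ h ∈ Subgroup.closure ({A, B} : Set SL(2, ℤ)),
      ((h * g) 0 0).natAbs + ((h * g) 1 0).natAbs < (g 0 0).natAbs + (g 1 0).natAbs := by
  have hA : A ∈ Subgroup.closure ({A, B} : Set SL(2, ℤ)) := Subgroup.subset_closure (by simp)
  have hB : B ∈ Subgroup.closure ({A, B} : Set SL(2, ℤ)) := Subgroup.subset_closure (by simp)
  obtain ⟨ha, -, -, hc'⟩ := mem_evenCongruenceSubgroup.1 hg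
  have eA : (A * g) 0 0 = g 0 0 + 2 * g 1 0 ∧ (A * g) 1 0 = g 1 0 := by
    simp [sl_two_mul_apply, coe_A]
  have eA' : (A⁻¹ * g) 0 0 = g 0 0 - 2 * g 1 0 ∧ (A⁻¹ * g) 1 0 = g 1 0 := by
    simp [sl_two_mul_apply, coe_A, sub_eq_add_neg]
  have eB : (B * g) 0 0 = g 0 0 ∧ (B * g) 1 0 = g 1 0 - 2 * g 0 0 := by
    simp [sl_two_mul_apply, coe_B]; ring
  have eB' : (B⁻¹ * g) 0 0 = g 0 0 ∧ (B⁻¹ * g) 1 0 = g 1 0 + 2 * g 0 0 := by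
    simp [sl_two_mul_apply, coe_B]; ring
  have key : (g 0 0 + 2 * g 1 0).natAbs < (g 0 0).natAbs ∨
      (g 0 0 - 2 * g 1 0).natAbs < (g 0 0).natAbs ∨
      (g 1 0 - 2 * g 0 0).natAbs < (g 1 0).natAbs ∨
      (g 1 0 + 2 * g 0 0).natAbs < (g 1 0).natAbs := by
    unfold Int.ModEq at ha hc'
    omega
  rcases key with h | h | h | h
  · exact ⟨A, hA, by rw [eA.1, eA.2]; omega⟩
  · exact ⟨A⁻¹, inv_mem hA, by rw [eA'.1, eA'.2]; omega⟩
  · exact ⟨B, hB, by rw [eB.1, eB.2]; omega⟩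
  · exact ⟨B⁻¹, inv_mem hB, by rw [eB'.1, eB'.2]; omega⟩

theorem closure_le_evenCongruenceSubgroup :
    Subgroup.closure ({A, B} : Set SL(2, ℤ)) ≤ evenCongruenceSubgroup := by
  rw [Subgroup.closure_le]
  rintro g (rfl | rfl)
  exacts [A_mem_evenCongruenceSubgroup, B_mem_evenCongruenceSubgroup]

theorem evenCongruenceSubgroup_le_closure :
    evenCongruenceSubgroup ≤ Subgroup.closure ({A, B} : Set SL(2, ℤ)) := by
  intro g hg
  induction hn : (g 0 0).natAbs + (g 1 0).natAbs using Nat.strong_induction_on generalizing g with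
  | _ n ih =>
    by_cases hc : g 1 0 = 0
    · obtain ⟨k, rfl⟩ := eq_A_zpow_of_apply_one_zero_eq_zero hg hc
      exact zpow_mem (Subgroup.subset_closure (by simp)) k
    · obtain ⟨h, hh, hlt⟩ := exists_mul_firstColumn_lt hg hc
      exact (Subgroup.mul_mem_cancel_left _ hh).1
        (ih _ (hn ▸ hlt) (mul_mem (closure_le_evenCongruenceSubgroup hh) hg) rfl)

theorem stmt_1 (g : SL(2, ℤ)) :
    g ∈ Subgroup.closure ({A, B} : Set SL(2, ℤ)) ↔
      (g 0 0) ≡ 1 [ZMOD 4] ∧ (g 1 1) ≡ 1 [ZMOD 4] ∧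
        (g 0 1) ≡ 0 [ZMOD 2] ∧ (g 1 0) ≡ 0 [ZMOD 2] := by
  rw [← mem_evenCongruenceSubgroup,
    le_antisymm closure_le_evenCongruenceSubgroup evenCongruenceSubgroup_le_closure]
end

section
/- The principal congruence subgroup Γ(4) of SL(2,ℤ) is generated by the six matrices [[1,-4],[0,1]], [[-3,-4],[4,5]], [[1,0],[4,1]], [[9,-4],[16,-7]], [[5,-4],[4,-3]], and [[9,-16],[4,-7]]. -/
open Matrix MatrixGroups CongruenceSubgroup

def g1 : SL(2, ℤ) := ⟨!![1, -4; 0, 1], by norm_num [Matrix.det_fin_two_of]⟩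
def g2 : SL(2, ℤ) := ⟨!![-3, -4; 4, 5], by norm_num [Matrix.det_fin_two_of]⟩
def g3 : SL(2, ℤ) := ⟨!![1, 0; 4, 1], by norm_num [Matrix.det_fin_two_of]⟩
def g4 : SL(2, ℤ) := ⟨!![9, -4; 16, -7], by norm_num [Matrix.det_fin_two_of]⟩
def g5 : SL(2, ℤ) := ⟨!![5, -4; 4, -3], by norm_num [Matrix.det_fin_two_of]⟩
def g6 : SL(2, ℤ) := ⟨!![9, -16; 4, -7], by norm_num [Matrix.det_fin_two_of]⟩

/-- The subgroup generated by `g1`, …, `g6`. -/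
abbrev generatedSubgroup : Subgroup SL(2, ℤ) := Subgroup.closure {g1, g2, g3, g4, g5, g6}

/-- A matrix sending `∞` to the `i`-th of the six cusps `∞, -1, 0, 1/2, 1, 2` of `Γ(4)`. -/
def cuspRep : Fin 6 → SL(2, ℤ) := ![
  ⟨!![1, 0; 0, 1], by norm_num [Matrix.det_fin_two_of]⟩,
  ⟨!![-1, 0; 1, -1], by norm_num [Matrix.det_fin_two_of]⟩,
  ⟨!![0, -1; 1, 0], by norm_num [Matrix.det_fin_two_of]⟩,
  ⟨!![1, 0; 2, 1], by norm_num [Matrix.det_fin_two_of]⟩,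
  ⟨!![1, 0; 1, 1], by norm_num [Matrix.det_fin_two_of]⟩,
  ⟨!![2, -1; 1, 0], by norm_num [Matrix.det_fin_two_of]⟩]

/-- Representatives for the cosets of `Γ(4)` in `SL(2, ℤ)`, up to sign. -/
def cosetRep (i : Fin 6) (k : Fin 4) : SL(2, ℤ) :=
  cuspRep i * ⟨!![1, (k : ℤ); 0, 1], by norm_num [Matrix.det_fin_two_of]⟩

/-- `γ` lies, up to sign, in the coset of one of the representatives `cosetRep i k`. -/
def IsCovered (γ : SL(2, ℤ)) : Prop :=
  ∃ h ∈ generatedSubgroup, ∃ i k, γ = h * cosetRep i k ∨ γ = -(h * cosetRep i k)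

lemma IsCovered.neg {γ : SL(2, ℤ)} (hγ : IsCovered γ) : IsCovered (-γ) := by
  obtain ⟨h, hh, i, k, rfl | rfl⟩ := hγ
  · exact ⟨h, hh, i, k, .inr rfl⟩
  · exact ⟨h, hh, i, k, .inl (neg_neg _)⟩

lemma IsCovered.mul_left {γ h : SL(2, ℤ)} (hγ : IsCovered γ) (hh : h ∈ generatedSubgroup) :
    IsCovered (h * γ) := by
  obtain ⟨h', hh', i, k, rfl | rfl⟩ := hγ
  · exact ⟨h * h', mul_mem hh hh', i, k, .inl (mul_assoc _ _ _).symm⟩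
  · exact ⟨h * h', mul_mem hh hh', i, k, .inr (by rw [mul_neg, mul_assoc])⟩

lemma IsCovered.mul_right {γ x : SL(2, ℤ)} (hγ : IsCovered γ)
    (hx : ∀ i k, IsCovered (cosetRep i k * x)) : IsCovered (γ * x) := by
  obtain ⟨h, hh, i, k, rfl | rfl⟩ := hγ
  · rw [mul_assoc]
    exact (hx i k).mul_left hh
  · rw [neg_mul, mul_assoc]
    exact ((hx i k).mul_left hh).neg

lemma g1_mem : g1 ∈ generatedSubgroup := Subgroup.subset_closure (by simp)

lemma g2_mem : g2 ∈ generatedSubgroup := Subgroup.subset_closure (by simp)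

lemma g3_mem : g3 ∈ generatedSubgroup := Subgroup.subset_closure (by simp)

lemma g4_mem : g4 ∈ generatedSubgroup := Subgroup.subset_closure (by simp)

lemma g5_mem : g5 ∈ generatedSubgroup := Subgroup.subset_closure (by simp)

lemma g6_mem : g6 ∈ generatedSubgroup := Subgroup.subset_closure (by simp)

lemma isCovered_cosetRep_mul_S (i : Fin 6) (k : Fin 4) :
    IsCovered (cosetRep i k * ModularGroup.S) := by
  fin_cases i <;> fin_cases k
  · exact ⟨1, one_mem _, 2, 0, .inl (by decide)⟩
  · exact ⟨g5, g5_mem, 4, 3, .inl (by decide)⟩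
  · exact ⟨1, one_mem _, 5, 0, .inl (by decide)⟩
  · exact ⟨g1⁻¹, inv_mem g1_mem, 1, 1, .inl (by decide)⟩
  · exact ⟨1, one_mem _, 2, 1, .inr (by decide)⟩
  · exact ⟨g1, g1_mem, 0, 3, .inr (by decide)⟩
  · exact ⟨g1 * g6, mul_mem g1_mem g6_mem, 5, 3, .inl (by decide)⟩
  · exact ⟨g2⁻¹ * g3⁻¹, mul_mem (inv_mem g2_mem) (inv_mem g3_mem), 3, 1, .inl (by decide)⟩
  · exact ⟨1, one_mem _, 0, 0, .inr (by decide)⟩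
  · exact ⟨1, one_mem _, 1, 0, .inl (by decide)⟩
  · exact ⟨g3⁻¹, inv_mem g3_mem, 3, 0, .inr (by decide)⟩
  · exact ⟨g3⁻¹, inv_mem g3_mem, 4, 0, .inr (by decide)⟩
  · exact ⟨g3, g3_mem, 2, 2, .inl (by decide)⟩
  · exact ⟨g3 * g2, mul_mem g3_mem g2_mem, 1, 3, .inr (by decide)⟩
  · exact ⟨g4⁻¹ * g5⁻¹, mul_mem (inv_mem g4_mem) (inv_mem g5_mem), 5, 2, .inl (by decide)⟩
  · exact ⟨g4⁻¹, inv_mem g4_mem, 4, 1, .inr (by decide)⟩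
  · exact ⟨g3, g3_mem, 2, 3, .inl (by decide)⟩
  · exact ⟨g4, g4_mem, 3, 3, .inl (by decide)⟩
  · exact ⟨g5⁻¹, inv_mem g5_mem, 5, 1, .inr (by decide)⟩
  · exact ⟨g5⁻¹, inv_mem g5_mem, 0, 1, .inr (by decide)⟩
  · exact ⟨1, one_mem _, 0, 2, .inr (by decide)⟩
  · exact ⟨g5, g5_mem, 4, 2, .inl (by decide)⟩
  · exact ⟨g5 * g4, mul_mem g5_mem g4_mem, 3, 2, .inr (by decide)⟩
  · exact ⟨g6⁻¹ * g1⁻¹, mul_mem (inv_mem g6_mem) (inv_mem g1_mem), 1, 2, .inr (by decide)⟩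

lemma isCovered_cosetRep_mul_T (i : Fin 6) (k : Fin 4) :
    IsCovered (cosetRep i k * ModularGroup.T) := by
  fin_cases i <;> fin_cases k
  · exact ⟨1, one_mem _, 0, 1, .inl (by decide)⟩
  · exact ⟨1, one_mem _, 0, 2, .inl (by decide)⟩
  · exact ⟨1, one_mem _, 0, 3, .inl (by decide)⟩
  · exact ⟨g1⁻¹, inv_mem g1_mem, 0, 0, .inl (by decide)⟩
  · exact ⟨1, one_mem _, 1, 1, .inl (by decide)⟩
  · exact ⟨1, one_mem _, 1, 2, .inl (by decide)⟩
  · exact ⟨1, one_mem _, 1, 3, .inl (by decide)⟩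
  · exact ⟨g2⁻¹, inv_mem g2_mem, 1, 0, .inl (by decide)⟩
  · exact ⟨1, one_mem _, 2, 1, .inl (by decide)⟩
  · exact ⟨1, one_mem _, 2, 2, .inl (by decide)⟩
  · exact ⟨1, one_mem _, 2, 3, .inl (by decide)⟩
  · exact ⟨g3⁻¹, inv_mem g3_mem, 2, 0, .inl (by decide)⟩
  · exact ⟨1, one_mem _, 3, 1, .inl (by decide)⟩
  · exact ⟨1, one_mem _, 3, 2, .inl (by decide)⟩
  · exact ⟨1, one_mem _, 3, 3, .inl (by decide)⟩
  · exact ⟨g4⁻¹, inv_mem g4_mem, 3, 0, .inl (by decide)⟩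
  · exact ⟨1, one_mem _, 4, 1, .inl (by decide)⟩
  · exact ⟨1, one_mem _, 4, 2, .inl (by decide)⟩
  · exact ⟨1, one_mem _, 4, 3, .inl (by decide)⟩
  · exact ⟨g5⁻¹, inv_mem g5_mem, 4, 0, .inl (by decide)⟩
  · exact ⟨1, one_mem _, 5, 1, .inl (by decide)⟩
  · exact ⟨1, one_mem _, 5, 2, .inl (by decide)⟩
  · exact ⟨1, one_mem _, 5, 3, .inl (by decide)⟩
  · exact ⟨g6⁻¹, inv_mem g6_mem, 5, 0, .inl (by decide)⟩

lemma isCovered_cosetRep_mul_T_inv (i : Fin 6) (k : Fin 4) :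
    IsCovered (cosetRep i k * ModularGroup.T⁻¹) := by
  fin_cases i <;> fin_cases k
  · exact ⟨g1, g1_mem, 0, 3, .inl (by decide)⟩
  · exact ⟨1, one_mem _, 0, 0, .inl (by decide)⟩
  · exact ⟨1, one_mem _, 0, 1, .inl (by decide)⟩
  · exact ⟨1, one_mem _, 0, 2, .inl (by decide)⟩
  · exact ⟨g2, g2_mem, 1, 3, .inl (by decide)⟩
  · exact ⟨1, one_mem _, 1, 0, .inl (by decide)⟩
  · exact ⟨1, one_mem _, 1, 1, .inl (by decide)⟩
  · exact ⟨1, one_mem _, 1, 2, .inl (by decide)⟩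
  · exact ⟨g3, g3_mem, 2, 3, .inl (by decide)⟩
  · exact ⟨1, one_mem _, 2, 0, .inl (by decide)⟩
  · exact ⟨1, one_mem _, 2, 1, .inl (by decide)⟩
  · exact ⟨1, one_mem _, 2, 2, .inl (by decide)⟩
  · exact ⟨g4, g4_mem, 3, 3, .inl (by decide)⟩
  · exact ⟨1, one_mem _, 3, 0, .inl (by decide)⟩
  · exact ⟨1, one_mem _, 3, 1, .inl (by decide)⟩
  · exact ⟨1, one_mem _, 3, 2, .inl (by decide)⟩
  · exact ⟨g5, g5_mem, 4, 3, .inl (by decide)⟩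
  · exact ⟨1, one_mem _, 4, 0, .inl (by decide)⟩
  · exact ⟨1, one_mem _, 4, 1, .inl (by decide)⟩
  · exact ⟨1, one_mem _, 4, 2, .inl (by decide)⟩
  · exact ⟨g6, g6_mem, 5, 3, .inl (by decide)⟩
  · exact ⟨1, one_mem _, 5, 0, .inl (by decide)⟩
  · exact ⟨1, one_mem _, 5, 1, .inl (by decide)⟩
  · exact ⟨1, one_mem _, 5, 2, .inl (by decide)⟩

lemma isCovered_all (γ : SL(2, ℤ)) : IsCovered γ := by
  have hγ : γ ∈ Subgroup.closure {ModularGroup.S, ModularGroup.T} := by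
    simp [SpecialLinearGroup.SL2Z_generators]
  induction hγ using Subgroup.closure_induction_right with
  | one => exact ⟨1, one_mem _, 0, 0, .inl (by decide)⟩
  | mul_right x _ y hy hx =>
    obtain rfl | rfl := hy
    · exact hx.mul_right isCovered_cosetRep_mul_S
    · exact hx.mul_right isCovered_cosetRep_mul_T
  | mul_inv_cancel x _ y hy hx =>
    obtain rfl | rfl := hy
    · have hS : ModularGroup.S⁻¹ = -ModularGroup.S := by decide
      rw [hS, mul_neg]
      exact (hx.mul_right isCovered_cosetRep_mul_S).neg
    · exact hx.mul_right isCovered_cosetRep_mul_T_inv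

lemma generatedSubgroup_le_Gamma_four : generatedSubgroup ≤ Gamma 4 := by
  rw [Subgroup.closure_le]
  rintro γ (rfl | rfl | rfl | rfl | rfl | rfl) <;>
    exact Gamma_mem.mpr (by decide)

lemma cosetRep_eq_one_of_mem_Gamma_four {i : Fin 6} {k : Fin 4}
    (h : cosetRep i k ∈ Gamma 4) : cosetRep i k = 1 := by
  rw [Gamma_mem] at h
  revert i k
  decide

lemma neg_cosetRep_notMem_Gamma_four (i : Fin 6) (k : Fin 4) :
    -cosetRep i k ∉ Gamma 4 := by
  rw [Gamma_mem]
  revert i k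
  decide

theorem stmt_3 :
    Subgroup.closure ({g1, g2, g3, g4, g5, g6} : Set SL(2, ℤ)) = Gamma 4 := by
  refine le_antisymm generatedSubgroup_le_Gamma_four fun γ hγ => ?_
  obtain ⟨h, hh, i, k, rfl | rfl⟩ := isCovered_all γ
  · have hr := (Subgroup.mul_mem_cancel_left _ (generatedSubgroup_le_Gamma_four hh)).mp hγ
    rwa [cosetRep_eq_one_of_mem_Gamma_four hr, mul_one]
  · rw [← mul_neg] at hγ
    exact absurd ((Subgroup.mul_mem_cancel_left _ (generatedSubgroup_le_Gamma_four hh)).mp hγ)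
      (neg_cosetRep_notMem_Gamma_four i k)
end

section
/- Let H be the subgroup of SL(2,ℤ) generated by A = [[1,2],[0,1]] and B = [[1,0],[-2,1]]. For every group homomorphism φ from H to (ℤ/2ℤ) × (ℤ/2ℤ) with φ(A) = (1,0) and φ(B) = (0,1), the kernel of φ is exactly the principal congruence subgroup Γ(4), i.e. for g ∈ H one has φ(g) = 0 if and only if g ≡ I (mod 4). -/
open Matrix MatrixGroups CongruenceSubgroup

/-- The subgroup of `SL(2,ℤ)` generated by `A` and `B`. -/
def H : Subgroup SL(2, ℤ) := Subgroup.closure {A, B}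

lemma A_mem_H : A ∈ H := Subgroup.subset_closure (by simp)

lemma B_mem_H : B ∈ H := Subgroup.subset_closure (by simp)

/-- Every homomorphism from `H` to the Klein four group with the prescribed values on `A` and `B`
reads off the halves of the off-diagonal entries modulo `2`. -/
lemma exists_entries_and_map_eq (φ : H →* Multiplicative (ZMod 2 × ZMod 2))
    (hA : φ ⟨A, A_mem_H⟩ = Multiplicative.ofAdd (1, 0))
    (hB : φ ⟨B, B_mem_H⟩ = Multiplicative.ofAdd (0, 1)) (g : SL(2, ℤ)) (hg : g ∈ H) :
    ∃ a b c d : ℤ, (g : Matrix (Fin 2) (Fin 2) ℤ) = !![1 + 4 * a, 2 * b; 2 * c, 1 + 4 * d] ∧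
      φ ⟨g, hg⟩ = Multiplicative.ofAdd ((b : ZMod 2), (c : ZMod 2)) := by
  have four_eq_zero : (4 : ZMod 2) = 0 := rfl
  induction hg using Subgroup.closure_induction with
  | mem x hx =>
    rcases hx with rfl | rfl
    · exact ⟨0, 1, 0, 0, by simp [A], by simpa using hA⟩
    · exact ⟨0, 0, -1, 0, by simp [B], by simpa using hB⟩
  | one => exact ⟨0, 0, 0, 0, by simp [Matrix.one_fin_two], map_one φ⟩
  | mul x y hx hy ihx ihy =>
    obtain ⟨a, b, c, d, hxm, hxφ⟩ := ihx
    obtain ⟨a', b', c', d', hym, hyφ⟩ := ihy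
    refine ⟨a + a' + 4 * a * a' + b * c', (1 + 4 * a) * b' + b * (1 + 4 * d'),
      c * (1 + 4 * a') + (1 + 4 * d) * c', d + d' + 4 * d * d' + c * b', ?_, ?_⟩
    · rw [Matrix.SpecialLinearGroup.coe_mul, hxm, hym, Matrix.mul_fin_two]
      congr! 3 <;> ring_nf
    · rw [show (⟨x * y, _⟩ : H) = ⟨x, hx⟩ * ⟨y, hy⟩ from rfl, map_mul, hxφ, hyφ, ← ofAdd_add]
      simp [four_eq_zero, add_comm]
  | inv x hx ih =>
    obtain ⟨a, b, c, d, hxm, hxφ⟩ := ih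
    refine ⟨d, -b, -c, a, ?_, ?_⟩
    · rw [Matrix.SpecialLinearGroup.coe_inv, hxm, Matrix.adjugate_fin_two_of]
      simp
    · rw [show (⟨x⁻¹, _⟩ : H) = ⟨x, hx⟩⁻¹ from rfl, map_inv, hxφ, ← ofAdd_neg]
      simp

theorem stmt_4 (φ : H →* Multiplicative (ZMod 2 × ZMod 2))
    (hA : φ ⟨A, A_mem_H⟩ = Multiplicative.ofAdd (1, 0))
    (hB : φ ⟨B, B_mem_H⟩ = Multiplicative.ofAdd (0, 1)) :
    ∀ g : H, φ g = 1 ↔ (g : SL(2, ℤ)) ∈ Gamma 4 := by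
  rintro ⟨g, hg⟩
  obtain ⟨a, b, c, d, hm, hφ⟩ := exists_entries_and_map_eq φ hA hB g hg
  have two_mul_eq_zero (n : ℤ) : (2 * n : ZMod 4) = 0 ↔ (n : ZMod 2) = 0 := by
    have h := ZMod.intCast_zmod_eq_zero_iff_dvd (2 * n) 4
    push_cast at h
    rw [h, ZMod.intCast_zmod_eq_zero_iff_dvd]
    omega
  have four_eq_zero : (4 : ZMod 4) = 0 := rfl
  rw [hφ, ofAdd_eq_one, Prod.mk_eq_zero, Gamma_mem]
  simp [hm, two_mul_eq_zero, four_eq_zero]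
end

section
/- In GL(2,ℂ), the three matrices A₁ = diag(1, e^{-2πi/3}), A₂ = [[-i/√3, -i/(2√3)],[-2 + 2i/√3, 1/2 - i/(2√3)]], A₃ = [[-i/√3, -1/4 + i/(4√3)],[-4i/√3, 1/2 - i/(2√3)]] generate a finite subgroup of order 24. -/
open Matrix Complex

/-- The monodromy matrix `M_{1,1/3} = diag(1, e^{-2πi/3})`. -/
noncomputable def A1 : Matrix (Fin 2) (Fin 2) ℂ :=
  !![1, 0; 0, Complex.exp (-(2 * Real.pi * Complex.I) / 3)]

/-- The monodromy matrix `M_{2,1/3}`. -/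
noncomputable def A2 : Matrix (Fin 2) (Fin 2) ℂ :=
  !![-Complex.I / Real.sqrt 3, -Complex.I / (2 * Real.sqrt 3);
     -2 + 2 * Complex.I / Real.sqrt 3, 1 / 2 - Complex.I / (2 * Real.sqrt 3)]

/-- The monodromy matrix `M_{3,1/3}`. -/
noncomputable def A3 : Matrix (Fin 2) (Fin 2) ℂ :=
  !![-Complex.I / Real.sqrt 3, -1 / 4 + Complex.I / (4 * Real.sqrt 3);
     -4 * Complex.I / Real.sqrt 3, 1 / 2 - Complex.I / (2 * Real.sqrt 3)]

namespace Subgroup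

/-- A finite set containing `1`, stable under right multiplication by the generators and their
inverses, and contained in the subgroup they generate, is that subgroup. -/
theorem closure_eq_coe_finset {G : Type*} [Group G] {s : Set G} {T : Finset G} (one : 1 ∈ T)
    (mul : ∀ x ∈ T, ∀ y ∈ s, x * y ∈ T) (mul_inv : ∀ x ∈ T, ∀ y ∈ s, x * y⁻¹ ∈ T)
    (le : ∀ x ∈ T, x ∈ closure s) : (closure s : Set G) = T := by
  refine Set.Subset.antisymm (fun x hx => ?_) le
  induction hx using closure_induction_right with
  | one => exact one
  | mul_right x _ y hy ih => exact mul x ih y hy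
  | mul_inv_cancel x _ y hy ih => exact mul_inv x ih y hy

end Subgroup

/-- The field `ℚ(ω)` with `ω² = -1 - ω`, in coordinates `⟨re, im⟩ = re + im • ω`. -/
abbrev EisensteinRat : Type := QuadraticAlgebra ℚ (-1) (-1)

namespace EisensteinRat

/-- `A1` over `ℚ(ω)`, where `ω` stands for `e^{-2πi/3}`. -/
def monodromy₁ : GL (Fin 2) EisensteinRat where
  val := !![1, 0; 0, ⟨0, 1⟩]
  inv := !![1, 0; 0, ⟨-1, -1⟩]
  val_inv := by decide +kernel
  inv_val := by decide +kernel

/-- `A2` over `ℚ(ω)`. -/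
def monodromy₂ : GL (Fin 2) EisensteinRat where
  val := !![⟨1 / 3, 2 / 3⟩, ⟨1 / 6, 1 / 3⟩; ⟨-8 / 3, -4 / 3⟩, ⟨2 / 3, 1 / 3⟩]
  inv := !![⟨-1 / 3, -2 / 3⟩, ⟨-1 / 6, 1 / 6⟩; ⟨-4 / 3, -8 / 3⟩, ⟨1 / 3, -1 / 3⟩]
  val_inv := by decide +kernel
  inv_val := by decide +kernel

/-- `A3` over `ℚ(ω)`. -/
def monodromy₃ : GL (Fin 2) EisensteinRat where
  val := !![⟨1 / 3, 2 / 3⟩, ⟨-1 / 3, -1 / 6⟩; ⟨4 / 3, 8 / 3⟩, ⟨2 / 3, 1 / 3⟩]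
  inv := !![⟨-1 / 3, -2 / 3⟩, ⟨-1 / 6, -1 / 3⟩; ⟨-4 / 3, 4 / 3⟩, ⟨1 / 3, -1 / 3⟩]
  val_inv := by decide +kernel
  inv_val := by decide +kernel

/-- Words in `a` and `b` representing the right cosets of `⟨a⟩` in the group of order 24 that
`monodromy₁` and `monodromy₂` generate. -/
def cosetWords {G : Type*} [Group G] (a b : G) : List G :=
  [1, b, b * b, b * a, b * b * a, b * a * a, b * b * a * a, b * a * a * b]

theorem cosetWords_subset {G : Type*} [Group G] {H : Subgroup G} {a b : G} (ha : a ∈ H)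
    (hb : b ∈ H) : ∀ x ∈ cosetWords a b, x ∈ H := by
  simp only [cosetWords, List.forall_mem_cons]
  refine ⟨one_mem H, hb, ?_, ?_, ?_, ?_, ?_, ?_, by simp⟩ <;>
    repeat' first | assumption | apply mul_mem

/-- The elements of the group generated by the three monodromy matrices. -/
def monodromyGroup : Finset (GL (Fin 2) EisensteinRat) :=
  ([1, monodromy₁, monodromy₁ * monodromy₁].flatMap fun x =>
    (cosetWords monodromy₁ monodromy₂).map (x * ·)).toFinset

theorem card_monodromyGroup : monodromyGroup.card = 24 := by decide +kernel

theorem closure_eq_monodromyGroup :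
    (Subgroup.closure {monodromy₁, monodromy₂, monodromy₃} : Set (GL (Fin 2) EisensteinRat)) =
      monodromyGroup := by
  apply Subgroup.closure_eq_coe_finset
  · decide +kernel
  · simp only [Set.mem_insert_iff, Set.mem_singleton_iff, forall_eq_or_imp, forall_eq]
    decide +kernel
  · simp only [Set.mem_insert_iff, Set.mem_singleton_iff, forall_eq_or_imp, forall_eq]
    decide +kernel
  · have h₁ : monodromy₁ ∈ Subgroup.closure {monodromy₁, monodromy₂, monodromy₃} :=
      Subgroup.subset_closure (by simp)
    have h₂ : monodromy₂ ∈ Subgroup.closure {monodromy₁, monodromy₂, monodromy₃} :=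
      Subgroup.subset_closure (by simp)
    intro x hx
    simp only [monodromyGroup, List.mem_toFinset, List.mem_flatMap, List.mem_map] at hx
    obtain ⟨y, hy, z, hz, rfl⟩ := hx
    refine mul_mem ?_ (cosetWords_subset h₁ h₂ z hz)
    simp only [List.mem_cons, List.not_mem_nil, or_false] at hy
    obtain rfl | rfl | rfl := hy
    exacts [one_mem _, h₁, mul_mem h₁ h₁]

theorem card_closure :
    Nat.card (Subgroup.closure {monodromy₁, monodromy₂, monodromy₃}) = 24 := by
  rw [← SetLike.coe_sort_coe, closure_eq_monodromyGroup]
  simp [card_monodromyGroup]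

theorem sqrt_three_sq : (Real.sqrt 3 : ℂ) ^ 2 = 3 := by
  rw [← Complex.ofReal_pow, Real.sq_sqrt (by norm_num)]
  norm_num

theorem exp_neg_two_pi_div_three :
    Complex.exp (-(2 * Real.pi * Complex.I) / 3) = -1 / 2 - Real.sqrt 3 / 2 * Complex.I := by
  have h : -(2 * Real.pi * Complex.I) / 3 = ((Real.pi / 3 - Real.pi : ℝ) : ℂ) * Complex.I := by
    push_cast
    ring
  rw [h, Complex.exp_mul_I, ← Complex.ofReal_cos, ← Complex.ofReal_sin, Real.cos_sub_pi,
    Real.sin_sub_pi, Real.cos_pi_div_three, Real.sin_pi_div_three]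
  push_cast
  ring

/-- The embedding of `ℚ(ω)` into `ℂ` sending `ω` to `e^{-2πi/3}`. -/
noncomputable def toComplex : EisensteinRat →ₐ[ℚ] ℂ :=
  QuadraticAlgebra.lift ⟨-1 / 2 - Real.sqrt 3 / 2 * Complex.I, by
    simp only [neg_smul, one_smul]
    linear_combination (1 / 4 : ℂ) * Complex.I ^ 2 * sqrt_three_sq + 3 / 4 * Complex.I_sq⟩

theorem toComplex_apply (z : EisensteinRat) :
    toComplex z = z.re + z.im * (-1 / 2 - Real.sqrt 3 / 2 * Complex.I) := by
  simp [toComplex, QuadraticAlgebra.lift, Rat.smul_def]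

theorem toComplex_injective : Function.Injective toComplex := by
  rw [injective_iff_map_eq_zero]
  intro z hz
  rw [toComplex_apply] at hz
  have him : z.im = 0 := by simpa using congrArg Complex.im hz
  have hre : z.re = 0 := by simpa [him] using hz
  exact QuadraticAlgebra.ext hre him

/-- The embedding `GL₂(ℚ(ω)) → GL₂(ℂ)` induced by `toComplex`. -/
noncomputable def toGLComplex : GL (Fin 2) EisensteinRat →* GL (Fin 2) ℂ :=
  GeneralLinearGroup.map toComplex.toRingHom

theorem toGLComplex_injective : Function.Injective toGLComplex :=
  Units.map_injective (Matrix.map_injective toComplex_injective)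

theorem coe_toGLComplex (g : GL (Fin 2) EisensteinRat) :
    (toGLComplex g : Matrix (Fin 2) (Fin 2) ℂ) =
      (g : Matrix (Fin 2) (Fin 2) EisensteinRat).map toComplex :=
  rfl

theorem inv_sqrt_three : (Real.sqrt 3 : ℂ)⁻¹ = Real.sqrt 3 / 3 := by
  rw [← sqrt_three_sq, sq, div_self_mul_self']

theorem coe_toGLComplex_monodromy₁ :
    (toGLComplex monodromy₁ : Matrix (Fin 2) (Fin 2) ℂ) = A1 := by
  rw [coe_toGLComplex, A1, exp_neg_two_pi_div_three]
  ext i j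
  fin_cases i <;> fin_cases j <;>
    simp [monodromy₁, toComplex_apply, QuadraticAlgebra.re_one, QuadraticAlgebra.im_one]

theorem coe_toGLComplex_monodromy₂ :
    (toGLComplex monodromy₂ : Matrix (Fin 2) (Fin 2) ℂ) = A2 := by
  rw [coe_toGLComplex, A2]
  ext i j
  fin_cases i <;> fin_cases j <;>
    simp [monodromy₂, toComplex_apply, div_eq_mul_inv, inv_sqrt_three] <;> ring

theorem coe_toGLComplex_monodromy₃ :
    (toGLComplex monodromy₃ : Matrix (Fin 2) (Fin 2) ℂ) = A3 := by
  rw [coe_toGLComplex, A3]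
  ext i j
  fin_cases i <;> fin_cases j <;>
    simp [monodromy₃, toComplex_apply, div_eq_mul_inv, inv_sqrt_three] <;> ring

end EisensteinRat

open EisensteinRat in
theorem stmt_9 :
    ∃ G1 G2 G3 : GL (Fin 2) ℂ,
      (G1 : Matrix (Fin 2) (Fin 2) ℂ) = A1 ∧ (G2 : Matrix (Fin 2) (Fin 2) ℂ) = A2 ∧
        (G3 : Matrix (Fin 2) (Fin 2) ℂ) = A3 ∧
        Nat.card (Subgroup.closure ({G1, G2, G3} : Set (GL (Fin 2) ℂ))) = 24 := by
  refine ⟨toGLComplex monodromy₁, toGLComplex monodromy₂, toGLComplex monodromy₃,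
    coe_toGLComplex_monodromy₁, coe_toGLComplex_monodromy₂, coe_toGLComplex_monodromy₃, ?_⟩
  rw [← card_closure, ← Subgroup.card_map_of_injective toGLComplex_injective,
    MonoidHom.map_closure, Set.image_insert_eq, Set.image_pair]
end

section
/- The matrices A₁ = diag(1, e^{-2πi/3}), A₂ = [[-i/√3, -i/(2√3)],[-2 + 2i/√3, 1/2 - i/(2√3)]], A₃ = [[-i/√3, -1/4 + i/(4√3)],[-4i/√3, 1/2 - i/(2√3)]] in GL(2,ℂ) satisfy the relations A₁A₃A₁ = A₃A₁A₃, (A₁A₃A₁)⁴ = I, and A₁A₃ = A₂A₁. -/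
open Matrix Complex

lemma fin_two_congr {R : Type*} {a b c d a' b' c' d' : R} (ha : a = a') (hb : b = b')
    (hc : c = c') (hd : d = d') : !![a, b; c, d] = !![a', b'; c', d'] := by
  rw [ha, hb, hc, hd]

lemma ofReal_sqrt_three_sq : (Real.sqrt 3 : ℂ) ^ 2 = 3 := by
  exact_mod_cast Real.sq_sqrt (show (0 : ℝ) ≤ 3 by norm_num)

lemma I_div_sqrt_three_sq : (Complex.I / (Real.sqrt 3 : ℂ)) ^ 2 = -1 / 3 := by
  rw [div_pow, ofReal_sqrt_three_sq, Complex.I_sq]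

lemma sqrt_three_mul_I :
    (Real.sqrt 3 : ℂ) * Complex.I = 3 * (Complex.I / (Real.sqrt 3 : ℂ)) := by
  have h := ofReal_sqrt_three_sq
  have h0 : (Real.sqrt 3 : ℂ) ≠ 0 := fun h0 => by simp [h0] at h
  field_simp
  exact h

lemma exp_neg_two_pi_I_div_three :
    Complex.exp (-(2 * Real.pi * Complex.I) / 3) =
      -1 / 2 - 3 / 2 * (Complex.I / (Real.sqrt 3 : ℂ)) := by
  have harg : -(2 * Real.pi * Complex.I) / 3 =
      ((Real.pi / 3 : ℝ) : ℂ) * Complex.I - Real.pi * Complex.I := by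
    push_cast
    ring
  rw [harg, Complex.exp_sub, Complex.exp_pi_mul_I, Complex.exp_mul_I, ← Complex.ofReal_cos,
    ← Complex.ofReal_sin, Real.cos_pi_div_three, Real.sin_pi_div_three]
  push_cast
  linear_combination -(1 / 2 : ℂ) * sqrt_three_mul_I

lemma A1_eq : A1 = !![1, 0; 0, -1 / 2 - 3 / 2 * (Complex.I / (Real.sqrt 3 : ℂ))] := by
  rw [A1, exp_neg_two_pi_I_div_three]

lemma A1_mul_A3 :
    let s : ℂ := Complex.I / (Real.sqrt 3 : ℂ)
    A1 * A3 = !![-s, (s - 1) / 4; 2 * s - 2, -(1 + s) / 2] := by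
  have hs := I_div_sqrt_three_sq
  rw [A1_eq, A3, Matrix.mul_fin_two]
  refine fin_two_congr ?_ ?_ ?_ ?_
  · ring
  · ring
  · linear_combination (6 : ℂ) * hs
  · linear_combination (3 / 4 : ℂ) * hs

lemma A2_mul_A1 :
    let s : ℂ := Complex.I / (Real.sqrt 3 : ℂ)
    A2 * A1 = !![-s, (s - 1) / 4; 2 * s - 2, -(1 + s) / 2] := by
  have hs := I_div_sqrt_three_sq
  rw [A1_eq, A2, Matrix.mul_fin_two]
  refine fin_two_congr ?_ ?_ ?_ ?_
  · ring
  · linear_combination (3 / 4 : ℂ) * hs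
  · ring
  · linear_combination (3 / 4 : ℂ) * hs

lemma A1_mul_A3_mul_A1 :
    let s : ℂ := Complex.I / (Real.sqrt 3 : ℂ)
    A1 * A3 * A1 = !![-s, (1 + s) / 4; 2 * s - 2, s] := by
  have hs := I_div_sqrt_three_sq
  rw [A1_mul_A3, A1_eq, Matrix.mul_fin_two]
  refine fin_two_congr ?_ ?_ ?_ ?_
  · ring
  · linear_combination (-3 / 8 : ℂ) * hs
  · ring
  · linear_combination (3 / 4 : ℂ) * hs

lemma A3_mul_A1_mul_A3 :
    let s : ℂ := Complex.I / (Real.sqrt 3 : ℂ)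
    A3 * A1 * A3 = !![-s, (1 + s) / 4; 2 * s - 2, s] := by
  have hs := I_div_sqrt_three_sq
  rw [Matrix.mul_assoc, A1_mul_A3, A3, Matrix.mul_fin_two]
  refine fin_two_congr ?_ ?_ ?_ ?_
  · linear_combination (3 / 2 : ℂ) * hs
  · linear_combination (-3 / 8 : ℂ) * hs
  · linear_combination (3 : ℂ) * hs
  · linear_combination (-3 / 4 : ℂ) * hs

lemma A1_mul_A3_mul_A1_sq : (A1 * A3 * A1) ^ 2 = -1 := by
  have hs := I_div_sqrt_three_sq
  rw [sq, A1_mul_A3_mul_A1, Matrix.mul_fin_two, Matrix.one_fin_two]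
  simp only [Matrix.neg_of, Matrix.neg_cons, Matrix.neg_empty]
  refine fin_two_congr ?_ ?_ ?_ ?_
  · linear_combination (3 / 2 : ℂ) * hs
  · ring
  · ring
  · linear_combination (3 / 2 : ℂ) * hs

theorem stmt_10 :
    A1 * A3 * A1 = A3 * A1 * A3 ∧ (A1 * A3 * A1) ^ 4 = 1 ∧ A1 * A3 = A2 * A1 := by
  refine ⟨A1_mul_A3_mul_A1.trans A3_mul_A1_mul_A3.symm, ?_, A1_mul_A3.trans A2_mul_A1.symm⟩
  rw [show (4 : ℕ) = 2 * 2 from rfl, pow_mul, A1_mul_A3_mul_A1_sq, neg_one_sq]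
end

section
/- In GL(2,ℂ), the three matrices B₁ = diag(1,-1), B₂ = [[-1/2, -i/(2√3)],[3√3 i/2, 1/2]], B₃ = [[-1/2, i/(2√3)],[-3√3 i/2, 1/2]] generate a finite subgroup of order 6. -/
open Matrix Complex

/-- The monodromy matrix `M_{1,1/2} = diag(1,-1)`. -/
noncomputable def B1 : Matrix (Fin 2) (Fin 2) ℂ := !![1, 0; 0, -1]

/-- The monodromy matrix `M_{2,1/2}`. -/
noncomputable def B2 : Matrix (Fin 2) (Fin 2) ℂ :=
  !![-1 / 2, -Complex.I / (2 * Real.sqrt 3);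
     3 * Real.sqrt 3 * Complex.I / 2, 1 / 2]

/-- The monodromy matrix `M_{3,1/2}`. -/
noncomputable def B3 : Matrix (Fin 2) (Fin 2) ℂ :=
  !![-1 / 2, Complex.I / (2 * Real.sqrt 3);
     -(3 * Real.sqrt 3 * Complex.I) / 2, 1 / 2]

section BraidInvolutions

variable {G : Type*} [Group G] {a b : G}

/-- Two involutions `a`, `b` satisfying the braid relation generate the set
`{1, a, b, aba, ab, ba}`. -/
theorem coe_closure_of_braid_involutions (ha : a * a = 1) (hb : b * b = 1)
    (hab : a * b * a = b * a * b) :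
    (Subgroup.closure {a, b, a * b * a} : Set G) =
      {1, a, b, a * b * a, a * b, b * a} := by
  have ha' (x : G) : x * a * a = x := by rw [mul_assoc, ha, mul_one]
  have hb' (x : G) : x * b * b = x := by rw [mul_assoc, hb, mul_one]
  have hia : a⁻¹ = a := inv_eq_of_mul_eq_one_left ha
  have hib : b⁻¹ = b := inv_eq_of_mul_eq_one_left hb
  have hmula (x : G) (hx : x ∈ ({1, a, b, a * b * a, a * b, b * a} : Set G)) :
      x * a ∈ ({1, a, b, a * b * a, a * b, b * a} : Set G) := by
    rcases hx with rfl | rfl | rfl | rfl | rfl | rfl <;> simp [ha, ha']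
  have hmulb (x : G) (hx : x ∈ ({1, a, b, a * b * a, a * b, b * a} : Set G)) :
      x * b ∈ ({1, a, b, a * b * a, a * b, b * a} : Set G) := by
    rcases hx with rfl | rfl | rfl | rfl | rfl | rfl <;> simp [hb, hb', hab]
  apply Set.Subset.antisymm
  · intro x hx
    induction hx using Subgroup.closure_induction_right with
    | one => simp
    | mul_right x hx y hy ih =>
      rcases hy with rfl | rfl | rfl
      · exact hmula _ ih
      · exact hmulb _ ih
      · simpa only [mul_assoc] using hmula _ (hmulb _ (hmula _ ih))
    | mul_inv_cancel x hx y hy ih =>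
      rcases hy with rfl | rfl | rfl
      · simpa only [hia] using hmula _ ih
      · simpa only [hib] using hmulb _ ih
      · simpa only [_root_.mul_inv_rev, hia, hib, mul_assoc] using hmula _ (hmulb _ (hmula _ ih))
  · have hca : a ∈ Subgroup.closure {a, b, a * b * a} := Subgroup.subset_closure (by simp)
    have hcb : b ∈ Subgroup.closure {a, b, a * b * a} := Subgroup.subset_closure (by simp)
    rintro x (rfl | rfl | rfl | rfl | rfl | rfl)
    · exact one_mem _
    · exact hca
    · exact hcb
    · exact mul_mem (mul_mem hca hcb) hca
    · exact mul_mem hca hcb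
    · exact mul_mem hcb hca

/-- Two distinct involutions satisfying the braid relation generate a group of order `6`. -/
theorem card_closure_of_braid_involutions (ha : a * a = 1) (hb : b * b = 1)
    (hab : a * b * a = b * a * b) (ha1 : a ≠ 1) (hne : a ≠ b) :
    Nat.card (Subgroup.closure {a, b, a * b * a}) = 6 := by
  classical
  have hb1 : b ≠ 1 := by
    rintro rfl
    exact ha1 (by simpa [ha] using hab.symm)
  have hab1 : a * b ≠ 1 := fun h => hne (mul_right_cancel (h.trans hb.symm))
  have hba1 : b * a ≠ 1 := fun h => hne (mul_right_cancel (h.trans ha.symm)).symm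
  have habb : a * b * a ≠ b := fun h => hba1 (by simpa [hab] using h)
  have hcomm : a * b ≠ b * a := fun h => habb (by rw [h, mul_assoc, ha, mul_one])
  have haba1 : a * b * a ≠ 1 := fun h => by
    have : a * b = a := mul_right_cancel (h.trans ha.symm)
    exact hb1 (by simpa using this)
  have hset : ({1, a, b, a * b * a, a * b, b * a} : Set G) =
      ↑({1, a, b, a * b * a, a * b, b * a} : Finset G) := by simp
  rw [← SetLike.coe_sort_coe, coe_closure_of_braid_involutions ha hb hab, hset,
    Nat.card_coe_set_eq, Set.ncard_coe_finset]
  have hbaba : b ≠ a * b * a := habb.symm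
  have haaba : a ≠ a * b * a := fun h => hba1 (by simpa [mul_assoc] using h)
  have habaab : a * b * a ≠ a * b := fun h => ha1 (by simpa using h)
  have hababa : a * b * a ≠ b * a := fun h => ha1 (by simpa using h)
  simp [Finset.card_insert_of_notMem, ha1, ha1.symm, hb1, hb1.symm, hne, hab1.symm,
    hba1.symm, haba1.symm, hbaba, haaba, habaab, hababa, hcomm]

end BraidInvolutions

theorem ofReal_sqrt_three_ne_zero : ((Real.sqrt 3 : ℝ) : ℂ) ≠ 0 := by
  rw [Complex.ofReal_ne_zero]
  positivity

theorem B1_mul_self : B1 * B1 = 1 := by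
  simp [B1, Matrix.one_fin_two]

theorem B2_mul_self : B2 * B2 = 1 := by
  have h0 := ofReal_sqrt_three_ne_zero
  ext i j
  fin_cases i <;> fin_cases j <;> simp [B2] <;> field_simp <;> norm_num

theorem B1_mul_B2_mul_B1 : B1 * B2 * B1 = B3 := by
  simp [B1, B2, B3, neg_div]

theorem B2_mul_B1_mul_B2 : B2 * B1 * B2 = B3 := by
  have h0 := ofReal_sqrt_three_ne_zero
  ext i j
  fin_cases i <;> fin_cases j <;> simp [B1, B2, B3] <;> field_simp <;> norm_num

theorem B1_ne_one : B1 ≠ 1 := by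
  intro h
  have := congrFun (congrFun h 1) 1
  norm_num [B1] at this

theorem B1_ne_B2 : B1 ≠ B2 := by
  intro h
  have := congrFun (congrFun h 1) 1
  norm_num [B1, B2] at this

theorem stmt_11 :
    ∃ G1 G2 G3 : GL (Fin 2) ℂ,
      (G1 : Matrix (Fin 2) (Fin 2) ℂ) = B1 ∧ (G2 : Matrix (Fin 2) (Fin 2) ℂ) = B2 ∧
        (G3 : Matrix (Fin 2) (Fin 2) ℂ) = B3 ∧
        Nat.card (Subgroup.closure ({G1, G2, G3} : Set (GL (Fin 2) ℂ))) = 6 := by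
  let a : GL (Fin 2) ℂ := ⟨B1, B1, B1_mul_self, B1_mul_self⟩
  let b : GL (Fin 2) ℂ := ⟨B2, B2, B2_mul_self, B2_mul_self⟩
  refine ⟨a, b, a * b * a, rfl, rfl, B1_mul_B2_mul_B1, ?_⟩
  apply card_closure_of_braid_involutions
  · exact Units.ext B1_mul_self
  · exact Units.ext B2_mul_self
  · exact Units.ext (B1_mul_B2_mul_B1.trans B2_mul_B1_mul_B2.symm)
  · exact fun h => B1_ne_one (congrArg Units.val h)
  · exact fun h => B1_ne_B2 (congrArg Units.val h)
end

section
/- In GL(2,ℂ), the three matrices C₁ = diag(1, e^{-4πi/3}), C₂ = [[i/√3, -√3 i/8],[8/3 + 8√3 i/9, 1/2 + i/(2√3)]], C₃ = [[i/√3, 3/16 + √3 i/16],[-16i/(3√3), 1/2 + √3 i/6]] generate a finite subgroup of order 24. -/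
open Matrix Complex

/-- The monodromy matrix `M_{1,2/3} = diag(1, e^{-4πi/3})`. -/
noncomputable def C1 : Matrix (Fin 2) (Fin 2) ℂ :=
  !![1, 0; 0, Complex.exp (-(4 * Real.pi * Complex.I) / 3)]

/-- The monodromy matrix `M_{2,2/3}`. -/
noncomputable def C2 : Matrix (Fin 2) (Fin 2) ℂ :=
  !![Complex.I / Real.sqrt 3, -(Real.sqrt 3 * Complex.I) / 8;
     8 / 3 + 8 * Real.sqrt 3 * Complex.I / 9, 1 / 2 + Complex.I / (2 * Real.sqrt 3)]

/-- The monodromy matrix `M_{3,2/3}`. -/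
noncomputable def C3 : Matrix (Fin 2) (Fin 2) ℂ :=
  !![Complex.I / Real.sqrt 3, 3 / 16 + Real.sqrt 3 * Complex.I / 16;
     -(16 * Complex.I) / (3 * Real.sqrt 3), 1 / 2 + Real.sqrt 3 * Complex.I / 6]

section BinaryTetrahedral

variable {G : Type*} [Group G] [HasDistribNeg G]

/-- The normal form `± q aᵏ` with `q ∈ {1, x, y, x y}` of the elements of a binary tetrahedral
group generated by quaternion units `x`, `y` and an element `a` of order three. -/
def binaryTetrahedralWord (a x y : G) (p : Bool × Fin 4 × Fin 3) : G :=
  (if p.1 then -1 else 1) * (![1, x, y, x * y] p.2.1 * ![1, a, a * a] p.2.2)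

theorem mul_binaryTetrahedralWord_mem_range {a x y : G} (hx : x * x = -1) (hy : y * y = -1)
    (hyx : y * x = -(x * y)) (hax : a * x = y * a) (hay : a * y = -(x * y * a))
    (ha : a * a * a = 1) (p : Bool × Fin 4 × Fin 3) :
    a * binaryTetrahedralWord a x y p ∈ Set.range (binaryTetrahedralWord a x y) ∧
      x * binaryTetrahedralWord a x y p ∈ Set.range (binaryTetrahedralWord a x y) ∧
      y * binaryTetrahedralWord a x y p ∈ Set.range (binaryTetrahedralWord a x y) := by
  have hx' (t : G) : x * (x * t) = -t := by rw [← mul_assoc, hx, neg_one_mul]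
  have hy' (t : G) : y * (y * t) = -t := by rw [← mul_assoc, hy, neg_one_mul]
  have hyx' (t : G) : y * (x * t) = -(x * (y * t)) := by
    rw [← mul_assoc, hyx, neg_mul, mul_assoc]
  have hax' (t : G) : a * (x * t) = y * (a * t) := by rw [← mul_assoc, hax, mul_assoc]
  have hay' (t : G) : a * (y * t) = -(x * (y * (a * t))) := by
    rw [← mul_assoc, hay, neg_mul, mul_assoc, mul_assoc]
  have hay₁ : a * y = -(x * (y * a)) := by rw [hay, mul_assoc]
  have ha₁ : a * (a * a) = 1 := by rw [← mul_assoc, ha]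
  obtain ⟨e, q, k⟩ := p
  refine ⟨⟨(e ^^ ![false, false, true, true] q, ![0, 2, 3, 1] q, k + 1), ?_⟩,
    ⟨(e ^^ ![false, true, false, true] q, ![1, 0, 3, 2] q, k), ?_⟩,
    ⟨(e ^^ ![false, true, true, false] q, ![2, 3, 0, 1] q, k), ?_⟩⟩ <;>
  cases e <;> fin_cases q <;> fin_cases k <;>
  simp [binaryTetrahedralWord, mul_assoc, hx, hy, hyx, hax, hay₁, ha₁, hx', hy', hyx', hax', hay']

theorem closure_eq_range_binaryTetrahedralWord {a x y : G} (hx : x * x = -1) (hy : y * y = -1)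
    (hyx : y * x = -(x * y)) (hax : a * x = y * a) (hay : a * y = -(x * y * a))
    (ha : a * a * a = 1) :
    (Subgroup.closure {a, x, y} : Set G) = Set.range (binaryTetrahedralWord a x y) := by
  have hmul := mul_binaryTetrahedralWord_mem_range hx hy hyx hax hay ha
  have hxi : x⁻¹ = x * x * x := by rw [inv_eq_iff_mul_eq_one]; simp [hx]
  have hyi : y⁻¹ = y * y * y := by rw [inv_eq_iff_mul_eq_one]; simp [hy]
  have hai : a⁻¹ = a * a := by rw [inv_eq_iff_mul_eq_one, ← mul_assoc, ha]
  apply Set.Subset.antisymm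
  · intro g hg
    induction hg using Subgroup.closure_induction_left with
    | one => exact ⟨(false, 0, 0), by simp [binaryTetrahedralWord]⟩
    | mul_left g hg t _ ht =>
      obtain ⟨p, rfl⟩ := ht
      obtain rfl | rfl | rfl := hg
      exacts [(hmul p).1, (hmul p).2.1, (hmul p).2.2]
    | inv_mul_cancel g hg t _ ht =>
      obtain ⟨p, rfl⟩ := ht
      obtain rfl | rfl | rfl := hg
      · obtain ⟨p, hp⟩ := (hmul p).1
        rw [hai, mul_assoc, ← hp]
        exact (hmul p).1
      · obtain ⟨p, hp⟩ := (hmul p).2.1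
        rw [hxi, mul_assoc, ← hp, mul_assoc]
        obtain ⟨p, hp⟩ := (hmul p).2.1
        rw [← hp]
        exact (hmul p).2.1
      · obtain ⟨p, hp⟩ := (hmul p).2.2
        rw [hyi, mul_assoc, ← hp, mul_assoc]
        obtain ⟨p, hp⟩ := (hmul p).2.2
        rw [← hp]
        exact (hmul p).2.2
  · rintro _ ⟨⟨e, q, k⟩, rfl⟩
    have hA : a ∈ Subgroup.closure {a, x, y} := Subgroup.subset_closure (by simp)
    have hX : x ∈ Subgroup.closure {a, x, y} := Subgroup.subset_closure (by simp)
    have hY : y ∈ Subgroup.closure {a, x, y} := Subgroup.subset_closure (by simp)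
    refine mul_mem ?_ (mul_mem ?_ ?_)
    · cases e
      · simp
      · simpa [hx] using mul_mem hX hX
    · fin_cases q
      exacts [one_mem _, hX, hY, mul_mem hX hY]
    · fin_cases k
      exacts [one_mem _, hA, mul_mem hA hA]

end BinaryTetrahedral

theorem of_fin_two_congr {R : Type*} {a b c d a' b' c' d' : R} (h₁ : a = a') (h₂ : b = b')
    (h₃ : c = c') (h₄ : d = d') : !![a, b; c, d] = !![a', b'; c', d'] := by
  rw [h₁, h₂, h₃, h₄]

theorem neg_of_fin_two {R : Type*} [Neg R] (a b c d : R) :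
    -!![a, b; c, d] = !![-a, -b; -c, -d] := by
  simp

theorem C1_eq : C1 = !![1, 0; 0, (3 * (I / Real.sqrt 3) - 1) / 2] := by
  have h3 : (Real.sqrt 3 : ℂ) ≠ 0 := by simp
  have hsq : (Real.sqrt 3 : ℂ) ^ 2 = 3 := by rw [← ofReal_pow]; simp
  have harg : -(4 * Real.pi * I) / 3 = ((2 * (Real.pi / 3) : ℝ) : ℂ) * I - 2 * Real.pi * I := by
    push_cast
    ring
  have hcos : Real.cos (2 * (Real.pi / 3)) = -1 / 2 := by
    rw [Real.cos_two_mul, Real.cos_pi_div_three]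
    norm_num
  have hsin : Real.sin (2 * (Real.pi / 3)) = Real.sqrt 3 / 2 := by
    rw [Real.sin_two_mul, Real.cos_pi_div_three, Real.sin_pi_div_three]
    ring
  have hexp : exp (-(4 * Real.pi * I) / 3) = (3 * (I / Real.sqrt 3) - 1) / 2 := by
    rw [harg, exp_periodic.sub_eq, exp_mul_I, ← ofReal_cos, ← ofReal_sin, hcos, hsin]
    push_cast
    field_simp
    linear_combination I * hsq
  rw [C1, hexp]

theorem C2_eq : C2 = !![I / Real.sqrt 3, -(3 * (I / Real.sqrt 3)) / 8;
    8 / 3 * (1 + I / Real.sqrt 3), (1 + I / Real.sqrt 3) / 2] := by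
  have h3 : (Real.sqrt 3 : ℂ) ≠ 0 := by simp
  have hsq : (Real.sqrt 3 : ℂ) ^ 2 = 3 := by rw [← ofReal_pow]; simp
  rw [C2]
  apply of_fin_two_congr <;> grind

theorem C3_eq : C3 = !![I / Real.sqrt 3, 3 / 16 * (1 + I / Real.sqrt 3);
    -(16 * (I / Real.sqrt 3)) / 3, (1 + I / Real.sqrt 3) / 2] := by
  have h3 : (Real.sqrt 3 : ℂ) ≠ 0 := by simp
  have hsq : (Real.sqrt 3 : ℂ) ^ 2 = 3 := by rw [← ofReal_pow]; simp
  rw [C3]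
  apply of_fin_two_congr <;> grind

/-- The diagonal reflection of order three with eigenvalue `(3 s - 1) / 2`, where `s² = -1/3`. -/
noncomputable def reflectionUnit (s : ℂ) (hs : s ^ 2 = -1 / 3) : GL (Fin 2) ℂ where
  val := !![1, 0; 0, (3 * s - 1) / 2]
  inv := !![1, 0; 0, (-1 - 3 * s) / 2]
  val_inv := by
    rw [mul_fin_two, one_fin_two]
    apply of_fin_two_congr <;> grind
  inv_val := by
    rw [mul_fin_two, one_fin_two]
    apply of_fin_two_congr <;> grind

/-- A quaternion unit, where `s² = -1/3`. -/
noncomputable def quaternionUnit (s : ℂ) (hs : s ^ 2 = -1 / 3) : GL (Fin 2) ℂ where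
  val := !![s, -(3 * s) / 8; -(16 * s) / 3, -s]
  inv := !![-s, 3 * s / 8; 16 * s / 3, s]
  val_inv := by
    rw [mul_fin_two, one_fin_two]
    apply of_fin_two_congr <;> grind
  inv_val := by
    rw [mul_fin_two, one_fin_two]
    apply of_fin_two_congr <;> grind

/-- The conjugate of `quaternionUnit` by `reflectionUnit`, where `s² = -1/3`. -/
noncomputable def quaternionUnitConj (s : ℂ) (hs : s ^ 2 = -1 / 3) : GL (Fin 2) ℂ where
  val := !![s, 3 / 16 * (s - 1); 8 / 3 * (1 + s), -s]
  inv := !![-s, -(3 / 16 * (s - 1)); -(8 / 3 * (1 + s)), s]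
  val_inv := by
    rw [mul_fin_two, one_fin_two]
    apply of_fin_two_congr <;> grind
  inv_val := by
    rw [mul_fin_two, one_fin_two]
    apply of_fin_two_congr <;> grind

theorem det_binaryTetrahedralWord (s : ℂ) (hs : s ^ 2 = -1 / 3) (p : Bool × Fin 4 × Fin 3) :
    ((binaryTetrahedralWord (reflectionUnit s hs) (quaternionUnit s hs)
      (quaternionUnitConj s hs) p : GL (Fin 2) ℂ) : Matrix (Fin 2) (Fin 2) ℂ).det =
        ![1, (3 * s - 1) / 2, (-1 - 3 * s) / 2] p.2.2 := by
  have hda : (reflectionUnit s hs : Matrix (Fin 2) (Fin 2) ℂ).det = (3 * s - 1) / 2 := by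
    simp [reflectionUnit, det_fin_two]
  have hdx : (quaternionUnit s hs : Matrix (Fin 2) (Fin 2) ℂ).det = 1 := by
    simp only [quaternionUnit, det_fin_two_of]
    grind
  have hdy : (quaternionUnitConj s hs : Matrix (Fin 2) (Fin 2) ℂ).det = 1 := by
    simp only [quaternionUnitConj, det_fin_two_of]
    grind
  obtain ⟨e, q, k⟩ := p
  have he : (((if e then -1 else 1 : GL (Fin 2) ℂ)) : Matrix (Fin 2) (Fin 2) ℂ).det = 1 := by
    cases e <;> simp [det_neg]
  have hq : ((![1, quaternionUnit s hs, quaternionUnitConj s hs,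
      quaternionUnit s hs * quaternionUnitConj s hs] q : GL (Fin 2) ℂ) :
      Matrix (Fin 2) (Fin 2) ℂ).det = 1 := by
    fin_cases q <;> simp [hdx, hdy]
  have hk : ((![1, reflectionUnit s hs, reflectionUnit s hs * reflectionUnit s hs] k :
      GL (Fin 2) ℂ) : Matrix (Fin 2) (Fin 2) ℂ).det =
      ![1, (3 * s - 1) / 2, (-1 - 3 * s) / 2] k := by
    fin_cases k <;> simp [hda]
    grind
  rw [binaryTetrahedralWord, Units.val_mul, Units.val_mul, det_mul, det_mul, he, hq, hk, one_mul,
    one_mul]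

theorem quaternionWord_row (s : ℂ) (hs : s ^ 2 = -1 / 3) (e : Bool) (q : Fin 4) :
    (((if e then -1 else 1) * ![1, quaternionUnit s hs, quaternionUnitConj s hs,
      quaternionUnit s hs * quaternionUnitConj s hs] q : GL (Fin 2) ℂ) :
      Matrix (Fin 2) (Fin 2) ℂ) 0 =
      (if e then -1 else 1 : ℂ) • ![![1, s, s, -s] q,
        ![0, -(3 * s) / 8, 3 / 16 * (s - 1), -(3 / 16 * (1 + s))] q] := by
  cases e <;> fin_cases q <;> ext i <;> fin_cases i <;>
    simp [quaternionUnit, quaternionUnitConj] <;> grind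

theorem binaryTetrahedralWord_injective (s : ℂ) (hs : s ^ 2 = -1 / 3) :
    Function.Injective (binaryTetrahedralWord (reflectionUnit s hs) (quaternionUnit s hs)
      (quaternionUnitConj s hs)) := by
  rintro ⟨e, q, k⟩ ⟨e', q', k'⟩ h
  obtain rfl : k = k' := by
    have hk := det_binaryTetrahedralWord s hs (e, q, k)
    rw [h, det_binaryTetrahedralWord] at hk
    clear h
    fin_cases k <;> fin_cases k' <;> simp at hk ⊢ <;> grind
  simp only [binaryTetrahedralWord, ← mul_assoc, mul_left_inj] at h
  have hrow := quaternionWord_row s hs e q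
  rw [h, quaternionWord_row] at hrow
  have h0 := congrFun hrow 0
  have h1 := congrFun hrow 1
  clear h hrow
  simp only [Pi.smul_apply, smul_eq_mul, cons_val_zero, cons_val_one] at h0 h1
  cases e <;> cases e' <;> fin_cases q <;> fin_cases q' <;> simp at h0 h1 ⊢ <;> grind

theorem stmt_13 :
    ∃ G1 G2 G3 : GL (Fin 2) ℂ,
      (G1 : Matrix (Fin 2) (Fin 2) ℂ) = C1 ∧ (G2 : Matrix (Fin 2) (Fin 2) ℂ) = C2 ∧
        (G3 : Matrix (Fin 2) (Fin 2) ℂ) = C3 ∧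
        Nat.card (Subgroup.closure ({G1, G2, G3} : Set (GL (Fin 2) ℂ))) = 24 := by
  obtain ⟨s, hsdef⟩ : ∃ s : ℂ, s = I / Real.sqrt 3 := ⟨_, rfl⟩
  have hs : s ^ 2 = -1 / 3 := by
    rw [hsdef, div_pow, I_sq, ← ofReal_pow]
    simp
  set a := reflectionUnit s hs with ha
  set x := quaternionUnit s hs with hx
  set y := quaternionUnitConj s hs with hy
  have hxx : x * x = -1 := by
    ext1
    simp only [hx, quaternionUnit, Units.val_mul, Units.val_neg, Units.val_one, mul_fin_two,
      one_fin_two, neg_of_fin_two]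
    apply of_fin_two_congr <;> grind
  have hyy : y * y = -1 := by
    ext1
    simp only [hy, quaternionUnitConj, Units.val_mul, Units.val_neg, Units.val_one, mul_fin_two,
      one_fin_two, neg_of_fin_two]
    apply of_fin_two_congr <;> grind
  have hyx : y * x = -(x * y) := by
    ext1
    simp only [hx, hy, quaternionUnit, quaternionUnitConj, Units.val_mul, Units.val_neg,
      mul_fin_two, neg_of_fin_two]
    apply of_fin_two_congr <;> grind
  have hax : a * x = y * a := by
    ext1
    simp only [ha, hx, hy, reflectionUnit, quaternionUnit, quaternionUnitConj, Units.val_mul,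
      mul_fin_two]
    apply of_fin_two_congr <;> grind
  have hay : a * y = -(x * y * a) := by
    ext1
    simp only [ha, hx, hy, reflectionUnit, quaternionUnit, quaternionUnitConj, Units.val_mul,
      Units.val_neg, mul_fin_two, neg_of_fin_two]
    apply of_fin_two_congr <;> grind
  have haa : a * a * a = 1 := by
    ext1
    simp only [ha, reflectionUnit, Units.val_mul, Units.val_one, mul_fin_two, one_fin_two]
    apply of_fin_two_congr <;> grind
  refine ⟨a, a * x, x * a, by rw [C1_eq, ← hsdef, ha, reflectionUnit], ?_, ?_, ?_⟩
  · rw [C2_eq, ← hsdef]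
    simp only [ha, hx, reflectionUnit, quaternionUnit, Units.val_mul, mul_fin_two]
    apply of_fin_two_congr <;> grind
  · rw [C3_eq, ← hsdef]
    simp only [ha, hx, reflectionUnit, quaternionUnit, Units.val_mul, mul_fin_two]
    apply of_fin_two_congr <;> grind
  · have hclosure : Subgroup.closure {a, a * x, x * a} = Subgroup.closure {a, x, y} := by
      apply le_antisymm
      · have hA : a ∈ Subgroup.closure {a, x, y} := Subgroup.subset_closure (by simp)
        have hX : x ∈ Subgroup.closure {a, x, y} := Subgroup.subset_closure (by simp)
        rw [Subgroup.closure_le]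
        rintro _ (rfl | rfl | rfl)
        exacts [hA, mul_mem hA hX, mul_mem hX hA]
      · have hA : a ∈ Subgroup.closure {a, a * x, x * a} := Subgroup.subset_closure (by simp)
        have hAX : a * x ∈ Subgroup.closure {a, a * x, x * a} :=
          Subgroup.subset_closure (by simp)
        rw [Subgroup.closure_le]
        rintro _ (h | h | h)
        · rwa [h]
        · rw [h]
          exact (Subgroup.mul_mem_cancel_left _ hA).1 hAX
        · rw [h]
          exact (Subgroup.mul_mem_cancel_right _ hA).1 (hax ▸ hAX)
    rw [hclosure]
    change Nat.card (Subgroup.closure {a, x, y} : Set (GL (Fin 2) ℂ)) = 24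
    rw [closure_eq_range_binaryTetrahedralWord hxx hyy hyx hax hay haa,
      Nat.card_range_of_injective (binaryTetrahedralWord_injective s hs)]
    simp
end
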